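/- (Global product estimate for the piecewise-constant L² projection in time; uniform-norm version of Lemma 5.4.) Let T > 0, N ∈ ℕ with N ≥ 1, set τ := T/N and tⁿ := n τ for n = 0, …, N. For an integrable function w : [0,T] → ℝ, let w̄ denote its piecewise-constant L²-orthogonal projection onto the partition, i.e. w̄(t) := (1/τ) ∫_{t^{n−1}}^{t^{n}} w(s) ds for t ∈ (t^{n−1}, t^{n}). If u, v : [0,T] → ℝ are twice continuously differentiable on [0,T], then sup over t in the union of the open subintervals (t^{n−1}, t^{n}), n = 1, …, N, of | ū(t) v̄(t) − \overline{uv}(t) | is at most (τ²/12) ( sup|u''| · sup|v| + sup|u'| · sup|v'| + sup|u| · sup|v''| ), where all suprema of u, v and their derivatives are taken over [0,T]. -/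

import Mathlib

open intervalIntegral

/-- Chebyshev's inequality for the covariance of two Lipschitz functions on an interval, in
unnormalised form. -/
theorem abs_integral_mul_integral_sub_le {a b A B : ℝ} {u v : ℝ → ℝ} (hab : a ≤ b)
    (hA : 0 ≤ A) (hu : ContinuousOn u (Set.Icc a b)) (hv : ContinuousOn v (Set.Icc a b))
    (hLu : ∀ s ∈ Set.Icc a b, ∀ t ∈ Set.Icc a b, |u s - u t| ≤ A * |s - t|)
    (hLv : ∀ s ∈ Set.Icc a b, ∀ t ∈ Set.Icc a b, |v s - v t| ≤ B * |s - t|) :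
    |(∫ t in a..b, u t) * (∫ t in a..b, v t) - (b - a) * ∫ t in a..b, u t * v t|
      ≤ A * B * (b - a) ^ 4 / 12 := by
  have hui : IntervalIntegrable u MeasureTheory.volume a b :=
    hu.intervalIntegrable_of_Icc hab
  have hvi : IntervalIntegrable v MeasureTheory.volume a b :=
    hv.intervalIntegrable_of_Icc hab
  have huvi : IntervalIntegrable (fun t => u t * v t) MeasureTheory.volume a b :=
    (hu.mul hv).intervalIntegrable_of_Icc hab
  set U := ∫ t in a..b, u t with hU
  set V := ∫ t in a..b, v t with hV
  set W := ∫ t in a..b, u t * v t with hW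
  have inner_eq (s : ℝ) : ∫ t in a..b, (u s - u t) * (v s - v t)
      = (b - a) * (u s * v s) - u s * V - v s * U + W := by
    have h : (fun t => (u s - u t) * (v s - v t))
        = fun t => u s * v s - u s * v t - v s * u t + u t * v t := by
      funext t; ring
    rw [h, integral_add _ huvi, integral_sub _ (hui.const_mul _),
      integral_sub intervalIntegrable_const (hvi.const_mul _),
      integral_const, integral_const_mul, integral_const_mul, smul_eq_mul]
    · exact intervalIntegrable_const.sub (hvi.const_mul _)
    · exact (intervalIntegrable_const.sub (hvi.const_mul _)).sub (hui.const_mul _)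
  have outer_eq : ∫ s in a..b, ((b - a) * (u s * v s) - u s * V - v s * U + W)
      = 2 * ((b - a) * W - U * V) := by
    rw [integral_add _ intervalIntegrable_const, integral_sub _ (hvi.mul_const _),
      integral_sub (huvi.const_mul _) (hui.mul_const _),
      integral_const, integral_const_mul, integral_mul_const, integral_mul_const, smul_eq_mul]
    · ring
    · exact (huvi.const_mul _).sub (hui.mul_const _)
    · exact ((huvi.const_mul _).sub (hui.mul_const _)).sub (hvi.mul_const _)
  have inner_le : ∀ s ∈ Set.Icc a b, |(b - a) * (u s * v s) - u s * V - v s * U + W|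
      ≤ A * B * (((s - a) ^ 3 - (s - b) ^ 3) / 3) := by
    intro s hs
    have hsq : ∫ t in a..b, A * B * (s - t) ^ 2 = A * B * (((s - a) ^ 3 - (s - b) ^ 3) / 3) := by
      rw [integral_const_mul, integral_comp_sub_left (fun x => x ^ 2) s, integral_pow]
      norm_num
    rw [← inner_eq, ← hsq, ← Real.norm_eq_abs]
    refine norm_integral_le_of_norm_le hab (.of_forall fun t ht => ?_)
      (Continuous.intervalIntegrable (by fun_prop) _ _)
    have ht' := Set.Ioc_subset_Icc_self ht
    calc ‖(u s - u t) * (v s - v t)‖ = |u s - u t| * |v s - v t| := by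
          rw [Real.norm_eq_abs, abs_mul]
      _ ≤ (A * |s - t|) * (B * |s - t|) :=
          mul_le_mul (hLu s hs t ht') (hLv s hs t ht') (abs_nonneg _) (by positivity)
      _ = A * B * (s - t) ^ 2 := by rw [← sq_abs (s - t)]; ring
  have outer_le : |2 * ((b - a) * W - U * V)|
      ≤ ∫ s in a..b, A * B * (((s - a) ^ 3 - (s - b) ^ 3) / 3) := by
    rw [← outer_eq, ← Real.norm_eq_abs]
    exact norm_integral_le_of_norm_le hab
      (.of_forall fun s hs => inner_le s (Set.Ioc_subset_Icc_self hs))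
      (Continuous.intervalIntegrable (by fun_prop) _ _)
  have hcube : ∫ s in a..b, A * B * (((s - a) ^ 3 - (s - b) ^ 3) / 3)
      = A * B * (b - a) ^ 4 / 6 := by
    rw [integral_const_mul, integral_div, integral_sub
      (Continuous.intervalIntegrable (by fun_prop) _ _)
      (Continuous.intervalIntegrable (by fun_prop) _ _),
      integral_comp_sub_right (fun x => x ^ 3) a, integral_comp_sub_right (fun x => x ^ 3) b,
      integral_pow, integral_pow]
    norm_num
    ring
  rw [hcube, abs_mul, abs_two, abs_sub_comm] at outer_le
  linarith

/-- A function with continuous derivative on `[a, b]` is Lipschitz there, with constant the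
supremum of the absolute value of the derivative. -/
theorem abs_sub_le_iSup_abs_deriv_mul {a b : ℝ} {f f' : ℝ → ℝ}
    (hf : ∀ t ∈ Set.Icc a b, HasDerivWithinAt f (f' t) (Set.Icc a b) t)
    (hf' : ContinuousOn f' (Set.Icc a b)) {s t : ℝ} (hs : s ∈ Set.Icc a b)
    (ht : t ∈ Set.Icc a b) :
    |f s - f t| ≤ (⨆ x : Set.Icc a b, |f' x|) * |s - t| := by
  have hbdd : BddAbove (Set.range fun x : Set.Icc a b => |f' x|) := by
    have h := isCompact_Icc.bddAbove_image hf'.abs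
    rwa [Set.image_eq_range] at h
  exact (convex_Icc a b).norm_image_sub_le_of_norm_hasDerivWithin_le hf
    (fun x hx => le_ciSup hbdd ⟨x, hx⟩) ht hs

/-- Global product estimate for the piecewise-constant L² projection in time
    (uniform-norm version of Lemma 5.4). On each open subinterval
    `(t^{n-1}, t^n)` of the uniform partition of `[0,T]` with step `τ = T/N`, the
    value of the projection is the average over that subinterval. -/
theorem global_product_estimate (T : ℝ) (hT : 0 < T) (N : ℕ) (hN : 1 ≤ N)
    (u u' u'' v v' v'' : ℝ → ℝ)
    (hu : ∀ t ∈ Set.Icc (0:ℝ) T, HasDerivWithinAt u (u' t) (Set.Icc 0 T) t)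
    (hu' : ∀ t ∈ Set.Icc (0:ℝ) T, HasDerivWithinAt u' (u'' t) (Set.Icc 0 T) t)
    (hu'' : ContinuousOn u'' (Set.Icc 0 T))
    (hv : ∀ t ∈ Set.Icc (0:ℝ) T, HasDerivWithinAt v (v' t) (Set.Icc 0 T) t)
    (hv' : ∀ t ∈ Set.Icc (0:ℝ) T, HasDerivWithinAt v' (v'' t) (Set.Icc 0 T) t)
    (hv'' : ContinuousOn v'' (Set.Icc 0 T)) :
    ∀ n : ℕ, 1 ≤ n → n ≤ N →
      |((1 / (T / N)) * ∫ t in ((n - 1 : ℕ) * (T / N) : ℝ)..((n : ℕ) * (T / N) : ℝ), u t) *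
            ((1 / (T / N)) * ∫ t in ((n - 1 : ℕ) * (T / N) : ℝ)..((n : ℕ) * (T / N) : ℝ), v t)
          - (1 / (T / N)) * ∫ t in ((n - 1 : ℕ) * (T / N) : ℝ)..((n : ℕ) * (T / N) : ℝ), u t * v t|
        ≤ (T / N) ^ 2 / 12 *
            ((⨆ t : Set.Icc (0:ℝ) T, |u'' t|) * (⨆ t : Set.Icc (0:ℝ) T, |v t|)
              + (⨆ t : Set.Icc (0:ℝ) T, |u' t|) * (⨆ t : Set.Icc (0:ℝ) T, |v' t|)
              + (⨆ t : Set.Icc (0:ℝ) T, |u t|) * (⨆ t : Set.Icc (0:ℝ) T, |v'' t|)) := by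
  intro n hn hnN
  have hNpos : (0 : ℝ) < N := by exact_mod_cast hN
  have hτ : 0 < T / N := div_pos hT hNpos
  have hlen : (n : ℝ) * (T / N) - ((n - 1 : ℕ) : ℝ) * (T / N) = T / N := by
    rw [Nat.cast_sub hn, Nat.cast_one]; ring
  have ha : (0 : ℝ) ≤ ((n - 1 : ℕ) : ℝ) * (T / N) := by positivity
  have hb : (n : ℝ) * (T / N) ≤ T :=
    calc (n : ℝ) * (T / N) ≤ N * (T / N) := by gcongr
      _ = T := by field_simp
  generalize ((n - 1 : ℕ) : ℝ) * (T / N) = a at *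
  generalize (n : ℝ) * (T / N) = b at *
  generalize T / N = τ at *
  have hsub : Set.Icc a b ⊆ Set.Icc 0 T := Set.Icc_subset_Icc ha hb
  have nonneg (f : ℝ → ℝ) : 0 ≤ ⨆ t : Set.Icc (0:ℝ) T, |f t| :=
    Real.iSup_nonneg fun _ => abs_nonneg _
  have key := abs_integral_mul_integral_sub_le (by linarith) (nonneg u')
    (fun t ht => (hu t (hsub ht)).continuousWithinAt.mono hsub)
    (fun t ht => (hv t (hsub ht)).continuousWithinAt.mono hsub)
    (fun s hs t ht => abs_sub_le_iSup_abs_deriv_mul hu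
      (fun x hx => (hu' x hx).continuousWithinAt) (hsub hs) (hsub ht))
    (fun s hs t ht => abs_sub_le_iSup_abs_deriv_mul hv
      (fun x hx => (hv' x hx).continuousWithinAt) (hsub hs) (hsub ht))
  rw [hlen] at key
  have hscale (x y z : ℝ) : 1 / τ * x * (1 / τ * y) - 1 / τ * z
      = (x * y - τ * z) / τ ^ 2 := by
    field_simp
  rw [hscale, abs_div, abs_of_pos (pow_pos hτ 2), div_le_iff₀ (pow_pos hτ 2)]
  refine key.trans ?_
  have h₁ := mul_nonneg (nonneg u'') (nonneg v)
  have h₂ := mul_nonneg (nonneg u) (nonneg v'')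
  nlinarith [mul_nonneg (pow_nonneg hτ.le 4) (add_nonneg h₁ h₂)]
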